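/- For every odd prime p with p < 1000 and every even integer k with 0 < k < p such that p divides the numerator of the Bernoulli number B_k, the prime p does not divide the numerator of the Bernoulli number B_{p+1−k}. -/

import Mathlib

/-! ### Evaluation order

The kernel evaluates lazily; `forceNat` and `forceInt` apply a function to an argument whose value
has been reduced to a literal. -/

/-- `f n`, evaluated after reducing `n` to a literal. -/
noncomputable def forceNat {α : Type*} (n : ℕ) (f : ℕ → α) : α :=
  Nat.rec (f 0) (fun m _ => f (Nat.succ m)) n

/-- `f z`, evaluated after reducing `z` to a literal. -/
noncomputable def forceInt {α : Type*} (z : ℤ) (f : ℤ → α) : α :=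
  Int.rec (fun n => forceNat n fun n => f (Int.ofNat n))
    (fun n => forceNat n fun n => f (Int.negSucc n)) z

theorem forceNat_eq {α : Type*} (n : ℕ) (f : ℕ → α) : forceNat n f = f n := by
  cases n <;> rfl

theorem forceInt_eq {α : Type*} (z : ℤ) (f : ℤ → α) : forceInt z f = f z := by
  cases z <;> simp [forceInt, forceNat_eq]

/-! ### The algorithm -/

/-- The binomial coefficient `N.choose (j + 2)`, computed from `c = N.choose j`. -/
def chooseStep (N j c : ℕ) : ℕ :=
  Nat.div (Nat.mul c (Nat.mul (Nat.sub N j) (Nat.sub N (Nat.succ j))))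
    (Nat.mul (Nat.succ j) (Nat.succ (Nat.succ j)))

/-- For `c = N.choose j`, the value `s + N.choose j * a₀ + N.choose (j + 2) * a₁ + ⋯`, where
`l = [a₀, a₁, …]`. -/
noncomputable def chooseSum (N : ℕ) (l : List ℤ) : ℕ → ℕ → ℤ → ℤ :=
  List.rec (fun _ _ s => s)
    (fun a _ ih j c s =>
      forceNat (chooseStep N j c) fun c' =>
        forceInt (Int.add s (Int.mul (Int.ofNat c) a)) fun s' =>
          forceNat (Nat.succ (Nat.succ j)) fun j' => ih j' c' s') l

/-- The list `[2 * E * B_{2n}, …, 2 * E * B_2, 2 * E * B_0]`, provided all its entries are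
integers. -/
noncomputable def scaledBernoulli (E : ℕ) : ℕ → Option (List ℤ)
  | 0 => some [Int.ofNat (2 * E)]
  | n + 1 => (scaledBernoulli E n).bind fun l =>
    forceNat (2 * n + 3) fun N =>
      forceNat (chooseStep N 1 N) fun c =>
        forceInt (Int.ofNat (N * E) - chooseSum N l 3 c 0) fun r =>
          forceInt (r / Int.ofNat N) fun a =>
            bif Nat.beq (r.natAbs % N) 0 then some (a :: l) else none

/-- Whether `p` has a proper divisor among the primes below `32`. -/
def trialComposite (p : ℕ) : Bool :=
  [2, 3, 5, 7, 11, 13, 17, 19, 23, 29, 31].any fun d => Nat.blt d p && Nat.beq (p % d) 0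

/-- The product of the integers `1 < m < n` which pass the test `trialComposite`. -/
def trialPrimorial : ℕ → ℕ
  | 0 => 1
  | n + 1 => bif Nat.blt n 2 || trialComposite n then trialPrimorial n else n * trialPrimorial n

/-- For each entry of `l` with index `1, …, p / 2`, whether it is divisible by `p ^ 2`. -/
def sqDvdFlags (p : ℕ) (l : List ℤ) : List Bool :=
  (l.take (p / 2 + 1)).tail.map fun a => Nat.beq (a.natAbs % (p * p)) 0

/-- No two entries of `l` with indices `i, j ≥ 1` such that `i + j = p / 2 + 1` are both divisible
by `p ^ 2`. -/
def noSqDvdPair (p : ℕ) (l : List ℤ) : Bool :=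
  (List.zipWith (fun x y => !(x && y)) (sqDvdFlags p l) (sqDvdFlags p l).reverse).all id

/-- Every odd `p < 1000` without small divisors divides `E` and satisfies `noSqDvdPair`. -/
def checkOddPrimes (E : ℕ) (l : List ℤ) : Bool :=
  (List.range 500).all fun q =>
    trialComposite (2 * q + 1) ||
      (Nat.beq (E % (2 * q + 1)) 0 && noSqDvdPair (2 * q + 1) l)

/-! ### Correctness -/

theorem chooseStep_choose (N j : ℕ) : chooseStep N j (N.choose j) = N.choose (j + 2) := by
  have h1 := Nat.choose_succ_right_eq N j
  have h2 := Nat.choose_succ_right_eq N (j + 1)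
  change N.choose j * ((N - j) * (N - (j + 1))) / ((j + 1) * (j + 2)) = _
  apply Nat.div_eq_of_eq_mul_left (by positivity)
  calc N.choose j * ((N - j) * (N - (j + 1)))
      = N.choose j * (N - j) * (N - (j + 1)) := by ring
    _ = N.choose (j + 1) * (N - (j + 1)) * (j + 1) := by rw [← h1]; ring
    _ = N.choose (j + 2) * ((j + 1) * (j + 2)) := by rw [← h2]; ring

theorem chooseSum_eq (N : ℕ) (f : ℕ → ℚ) (n : ℕ) (l : List ℤ) (j : ℕ) (s : ℤ)
    (hl : l.map (Int.cast : ℤ → ℚ) = (List.range n).reverse.map f) (hj : j + 2 * n = N + 2) :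
    (chooseSum N l j (N.choose j) s : ℚ) =
      s + ∑ i ∈ Finset.range n, (N.choose (2 * i) : ℚ) * f i := by
  induction n generalizing l j s with
  | zero =>
    obtain rfl : l = [] := by simpa using hl
    simp [chooseSum]
  | succ n ih =>
    rcases l with _ | ⟨a, l⟩
    · simp at hl
    rw [List.range_succ] at hl
    simp only [List.map_cons, List.reverse_append, List.reverse_singleton, List.singleton_append,
      List.cons.injEq] at hl
    have hstep : chooseSum N (a :: l) j (N.choose j) s =
        chooseSum N l (j + 2) (N.choose (j + 2)) (s + (N.choose j : ℤ) * a) := by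
      rw [← chooseStep_choose]
      simp only [chooseSum, forceNat_eq, forceInt_eq]
      rfl
    have hsymm : N.choose (2 * n) = N.choose j := Nat.choose_symm_of_eq_add (by omega)
    rw [hstep, ih l (j + 2) _ hl.2 (by omega), Finset.sum_range_succ, hsymm, ← hl.1]
    push_cast
    ring

theorem Finset.sum_range_two_mul_add_one {M : Type*} [AddCommMonoid M] (f : ℕ → M) (n : ℕ) :
    ∑ k ∈ Finset.range (2 * n + 1), f k =
      ∑ i ∈ Finset.range (n + 1), f (2 * i) + ∑ i ∈ Finset.range n, f (2 * i + 1) := by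
  induction n with
  | zero => simp
  | succ n ih =>
    rw [show 2 * (n + 1) + 1 = 2 * n + 1 + 1 + 1 by ring, Finset.sum_range_succ,
      Finset.sum_range_succ, ih, Finset.sum_range_succ (fun i => f (2 * i)) (n + 1),
      Finset.sum_range_succ (fun i => f (2 * i + 1)) n, mul_add, mul_one]
    abel

theorem sum_choose_mul_bernoulli_two_mul (n : ℕ) :
    ∑ i ∈ Finset.range (n + 2), ((2 * n + 3).choose (2 * i) : ℚ) * bernoulli (2 * i) =
      (2 * n + 3) / 2 := by
  have h := sum_bernoulli (2 * (n + 1) + 1)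
  rw [if_neg (by omega), Finset.sum_range_two_mul_add_one, Finset.sum_range_succ' _ n] at h
  have hodd : ∀ i ∈ Finset.range n, ((2 * (n + 1) + 1).choose (2 * (i + 1) + 1) : ℚ) *
      bernoulli (2 * (i + 1) + 1) = 0 := fun i _ => by
    rw [bernoulli_eq_zero_of_odd ⟨i + 1, rfl⟩ (by omega), mul_zero]
  rw [Finset.sum_eq_zero hodd] at h
  rw [show 2 * (n + 1) + 1 = 2 * n + 3 by ring] at h
  simp only [mul_zero, zero_add, Nat.choose_one_right, bernoulli_one] at h
  push_cast at h
  linarith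

theorem scaledBernoulli_spec {E n : ℕ} {l : List ℤ} (h : scaledBernoulli E n = some l) :
    l.map (Int.cast : ℤ → ℚ) =
      (List.range (n + 1)).reverse.map fun i => 2 * E * bernoulli (2 * i) := by
  induction n generalizing l with
  | zero =>
    obtain rfl : [Int.ofNat (2 * E)] = l := by simpa [scaledBernoulli] using h
    simp
  | succ n ih =>
    rw [scaledBernoulli, Option.bind_eq_some_iff] at h
    obtain ⟨l', hl', h⟩ := h
    have hs := ih hl'
    simp only [forceNat_eq, forceInt_eq] at h
    have hc : chooseStep (2 * n + 3) 1 (2 * n + 3) = (2 * n + 3).choose 3 := by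
      simpa using chooseStep_choose (2 * n + 3) 1
    rw [hc] at h
    have hsum := chooseSum_eq (2 * n + 3) _ (n + 1) l' 3 0 hs (by omega)
    set S := chooseSum (2 * n + 3) l' 3 ((2 * n + 3).choose 3) 0
    have hrec := sum_choose_mul_bernoulli_two_mul n
    rw [Finset.sum_range_succ] at hrec
    have hchoose : (2 * n + 3).choose (2 * (n + 1)) = 2 * n + 3 := by
      rw [Nat.choose_symm_of_eq_add (show 2 * n + 3 = 2 * (n + 1) + 1 by ring)]
      simp
    rw [hchoose] at hrec
    have hpull : ∑ i ∈ Finset.range (n + 1),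
        ((2 * n + 3).choose (2 * i) : ℚ) * (2 * E * bernoulli (2 * i)) =
        2 * E * ∑ i ∈ Finset.range (n + 1),
          ((2 * n + 3).choose (2 * i) : ℚ) * bernoulli (2 * i) := by
      rw [Finset.mul_sum]
      exact Finset.sum_congr rfl fun i _ => by ring
    rw [hpull] at hsum
    rw [cond_eq_ite] at h
    split_ifs at h with hmod
    have hdvd : ((2 * n + 3 : ℕ) : ℤ) ∣ Int.ofNat ((2 * n + 3) * E) - S :=
      Int.natCast_dvd.mpr (Nat.dvd_of_mod_eq_zero (Nat.eq_of_beq_eq_true hmod))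
    obtain ⟨b, hb⟩ := hdvd
    obtain rfl : b :: l' = l := by
      rw [hb, Int.ofNat_eq_natCast, Int.mul_ediv_cancel_left _ (by positivity)] at h
      exact Option.some.inj h
    rw [List.range_succ]
    simp only [List.map_cons, List.reverse_append, List.reverse_singleton, List.singleton_append,
      hs, List.cons.injEq, and_true]
    have hb' : (((2 * n + 3) * E : ℕ) : ℚ) - S = (2 * n + 3) * b := by
      have := congrArg (Int.cast : ℤ → ℚ) hb
      rw [Int.ofNat_eq_natCast] at this
      push_cast at this ⊢
      exact this
    have hN : (2 * n + 3 : ℚ) ≠ 0 := by positivity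
    apply mul_left_cancel₀ hN
    rw [← hb', hsum]
    push_cast at hrec ⊢
    linear_combination (-2 * E : ℚ) * hrec

theorem not_trialComposite {p : ℕ} (hp : p.Prime) : trialComposite p = false := by
  rw [trialComposite, List.any_eq_false]
  intro d hd h
  rw [Bool.and_eq_true] at h
  have hlt : d < p := by simpa [Nat.blt_eq] using h.1
  have hdvd : d ∣ p := Nat.dvd_of_mod_eq_zero (Nat.eq_of_beq_eq_true h.2)
  rcases (Nat.dvd_prime hp).mp hdvd with rfl | rfl
  · simp at hd
  · exact hlt.false

theorem not_sq_dvd_pair {p : ℕ} {l : List ℤ} (h : noSqDvdPair p l = true) {i j : ℕ}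
    (hij : i + j + 1 = p / 2) (hl : p / 2 < l.length) {a b : ℤ} (ha : l[i + 1]? = some a)
    (hb : l[j + 1]? = some b) (hpa : (p * p : ℤ) ∣ a) (hpb : (p * p : ℤ) ∣ b) : False := by
  have flag : ∀ {t : ℕ} {c : ℤ}, t < p / 2 → l[t + 1]? = some c → (p * p : ℤ) ∣ c →
      (sqDvdFlags p l)[t]? = some true := by
    intro t c ht hc hpc
    have : p * p ∣ c.natAbs := Int.natCast_dvd.mp (by exact_mod_cast hpc)
    simp [sqDvdFlags, ht, hc, Nat.mod_eq_zero_of_dvd this]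
  have hlen : (sqDvdFlags p l).length = p / 2 := by
    simp [sqDvdFlags]
    omega
  have hi := flag (by omega) ha hpa
  have hj := flag (by omega) hb hpb
  have hrev : (sqDvdFlags p l).reverse[i]? = some true := by
    rw [List.getElem?_reverse (by omega), hlen, show p / 2 - 1 - i = j by omega, hj]
  rw [noSqDvdPair, List.all_eq_true] at h
  have hmem : false ∈ List.zipWith (fun x y => !(x && y)) (sqDvdFlags p l)
      (sqDvdFlags p l).reverse :=
    List.mem_of_getElem? (i := i) (by simp [List.getElem?_zipWith, hi, hrev])
  exact absurd (h false hmem) (by simp)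

theorem sq_dvd_of_dvd_num {p E : ℕ} {a : ℤ} {q : ℚ} (hp : p.Prime) (hE : p ∣ E)
    (ha : (a : ℚ) = 2 * E * q) (hq : (p : ℤ) ∣ q.num) : (p * p : ℤ) ∣ a := by
  have hmul : a * q.den = 2 * E * q.num := by
    have : (a : ℚ) * q.den = 2 * E * q.num := by rw [ha, mul_assoc, Rat.mul_den_eq_num]
    exact_mod_cast this
  have hcop : IsCoprime (p * p : ℤ) q.den := by
    have : IsCoprime (p : ℤ) q.den := by
      rw [Nat.isCoprime_iff_coprime, hp.coprime_iff_not_dvd]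
      intro hden
      exact hp.one_lt.ne' (Nat.eq_one_of_dvd_coprimes q.reduced (Int.natCast_dvd.mp hq) hden)
    exact this.mul_left this
  refine hcop.dvd_of_dvd_mul_right ?_
  rw [hmul]
  exact mul_dvd_mul (Dvd.dvd.mul_left (Int.natCast_dvd_natCast.mpr hE) 2) hq

theorem any_checkOddPrimes :
    forceNat (trialPrimorial 1000)
      (fun E => (scaledBernoulli E 498).any fun l => checkOddPrimes E l.reverse) = true := by
  decide +kernel


/-- For every odd prime `p < 1000` and every even integer `k` with `0 < k < p` such that
`p` divides the numerator of the Bernoulli number `B_k`, the prime `p` does not divide the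
numerator of the Bernoulli number `B_{p+1-k}`. -/
theorem stmt11 (p k : ℕ) (hp : p.Prime) (hodd : Odd p) (hlt : p < 1000)
    (hkeven : Even k) (hkpos : 0 < k) (hklt : k < p)
    (hdvd : (p : ℤ) ∣ (bernoulli k).num) :
    ¬ (p : ℤ) ∣ (bernoulli (p + 1 - k)).num := by
  have hcheck := any_checkOddPrimes
  rw [forceNat_eq, Option.any_eq_true] at hcheck
  generalize trialPrimorial 1000 = E at hcheck
  obtain ⟨l, hl, hcheck⟩ := hcheck
  have hspec : l.reverse.map (Int.cast : ℤ → ℚ) =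
      (List.range 499).map fun i => 2 * E * bernoulli (2 * i) := by
    rw [List.map_reverse, scaledBernoulli_spec hl, List.map_reverse, List.reverse_reverse]
  have hlen : l.reverse.length = 499 := by simpa using congrArg List.length hspec
  have hentry : ∀ i, i < 499 → ∃ a : ℤ, l.reverse[i]? = some a ∧
      (a : ℚ) = 2 * E * bernoulli (2 * i) := by
    intro i hi
    have h := congrArg (fun L => L[i]?) hspec
    simpa [hi, eq_comm, -List.map_reverse, -List.getElem?_reverse] using h
  obtain ⟨m, rfl⟩ := hodd
  rw [checkOddPrimes, List.all_eq_true] at hcheck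
  have hpcheck := hcheck m (List.mem_range.mpr (by omega))
  rw [not_trialComposite hp, Bool.false_or, Bool.and_eq_true] at hpcheck
  have hE : 2 * m + 1 ∣ E := Nat.dvd_of_mod_eq_zero (Nat.eq_of_beq_eq_true hpcheck.1)
  obtain ⟨i, rfl⟩ : ∃ i, k = 2 * (i + 1) := by
    obtain ⟨t, rfl⟩ := hkeven
    exact ⟨t - 1, by omega⟩
  obtain ⟨j, rfl⟩ : ∃ j, m = i + j + 1 := ⟨m - i - 1, by omega⟩
  rw [show 2 * (i + j + 1) + 1 + 1 - 2 * (i + 1) = 2 * (j + 1) by omega]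
  intro hdvd'
  have hm : i + j + 1 < 499 := by
    by_contra hge
    have hm : i + j + 1 = 499 := by omega
    rw [hm] at hp
    norm_num at hp
  obtain ⟨a, ha, haB⟩ := hentry (i + 1) (by omega)
  obtain ⟨b, hb, hbB⟩ := hentry (j + 1) (by omega)
  exact not_sq_dvd_pair hpcheck.2 (by omega) (by omega) ha hb
    (sq_dvd_of_dvd_num hp hE haB hdvd) (sq_dvd_of_dvd_num hp hE hbB hdvd')
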